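/- arXiv:1609.02442 — 8 statements merged into one kernel-verified Lean document; each statement's English description precedes it below -/
import Mathlib

section
/- Let n be an even positive integer and let k = n/2. For every family C of k-element subsets of {1,...,n} such that any two distinct members of C have symmetric difference of size at least 4, there exists an N-free family F of subsets of {1,...,n} with |F| ≥ C(n,k) + |C|. (In particular, La(n,N) ≥ C(n,k) + A(n,4,k).) -/
/-- A family is N-free if there are no four distinct sets `W, X, Y, Z` in it
with `W ⊆ X`, `Y ⊆ X`, `Y ⊆ Z`. -/
def IsNFree {α : Type*} (F : Finset (Finset α)) : Prop :=
  ¬ ∃ W X Y Z : Finset α, W ∈ F ∧ X ∈ F ∧ Y ∈ F ∧ Z ∈ F ∧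
    W ≠ X ∧ W ≠ Y ∧ W ≠ Z ∧ X ≠ Y ∧ X ≠ Z ∧ Y ≠ Z ∧
    W ⊆ X ∧ Y ⊆ X ∧ Y ⊆ Z

/-- A constant-weight-`k` single-error-correcting code: all members have
cardinality `k` and distinct members have symmetric difference of size ≥ 4. -/
def IsSECCode {α : Type*} [DecidableEq α] (k : ℕ) (C : Finset (Finset α)) : Prop :=
  (∀ c ∈ C, c.card = k) ∧
    ∀ c₁ ∈ C, ∀ c₂ ∈ C, c₁ ≠ c₂ → 4 ≤ (symmDiff c₁ c₂).card


/-- Toggling a single element changes the cardinality by exactly one. -/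
lemma card_symmDiff_singleton {α : Type*} [DecidableEq α] (s : Finset α) (a : α) :
    (symmDiff s {a}).card = s.card + 1 ∨ (symmDiff s {a}).card + 1 = s.card := by
  by_cases ha : a ∈ s
  · right
    have h : symmDiff s {a} = s.erase a := by
      ext x
      by_cases hx : x = a <;> simp [Finset.mem_symmDiff, hx, ha]
    rw [h, Finset.card_erase_add_one ha]
  · left
    have h : symmDiff s {a} = insert a s := by
      ext x
      by_cases hx : x = a <;> simp [Finset.mem_symmDiff, hx, ha]
    rw [h, Finset.card_insert_of_notMem ha]

/-- The Hamming distance between nested sets is the difference of their cardinalities. -/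
lemma card_add_card_symmDiff_of_subset {α : Type*} [DecidableEq α] {s t : Finset α}
    (h : s ⊆ t) : s.card + (symmDiff s t).card = t.card := by
  rw [symmDiff_of_le h, add_comm, Finset.card_sdiff_add_card_eq_card h]

/-- The triangle inequality for the Hamming distance on finite sets. -/
lemma card_symmDiff_le_add {α : Type*} [DecidableEq α] (s t u : Finset α) :
    (symmDiff s u).card ≤ (symmDiff s t).card + (symmDiff t u).card :=
  (Finset.card_le_card (symmDiff_triangle s t u)).trans (Finset.card_union_le _ _)

/-- A layer together with a family of sets in the two neighbouring layers is N-free,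
provided distinct members of the family are at Hamming distance at least `4`. -/
lemma isNFree_powersetCard_union {α : Type*} [Fintype α] [DecidableEq α] {k : ℕ}
    {T : Finset (Finset α)} (hcard : ∀ t ∈ T, t.card = k + 1 ∨ t.card + 1 = k)
    (hdist : ∀ t₁ ∈ T, ∀ t₂ ∈ T, t₁ ≠ t₂ → 4 ≤ (symmDiff t₁ t₂).card) :
    IsNFree (Finset.powersetCard k Finset.univ ∪ T) := by
  have key : ∀ U V : Finset α, U ∈ Finset.powersetCard k Finset.univ ∪ T →
      V ∈ Finset.powersetCard k Finset.univ ∪ T → U ≠ V → U ⊆ V →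
      (U ∈ T ∧ V ∉ T ∨ U ∉ T ∧ V ∈ T) ∧ (symmDiff U V).card ≤ 1 := by
    intro U V hU hV hne hsub
    have hlt := Finset.card_lt_card (Finset.ssubset_iff_subset_ne.2 ⟨hsub, hne⟩)
    have hd := card_add_card_symmDiff_of_subset hsub
    simp only [Finset.mem_union, Finset.mem_powersetCard_univ] at hU hV
    have hUT := hcard U
    have hVT := hcard V
    have hUV := hdist U
    by_cases h₁ : U ∈ T <;> by_cases h₂ : V ∈ T
    · have h₃ := hUV h₁ V h₂ hne
      have h₄ := hUT h₁
      have h₅ := hVT h₂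
      omega
    · have h₃ := hUT h₁
      simp only [h₁, h₂, or_false] at hV ⊢
      simp
      omega
    · have h₃ := hVT h₂
      simp only [h₁, h₂, or_false] at hU ⊢
      simp
      omega
    · simp only [h₁, h₂, or_false] at hU hV
      omega
  rintro ⟨W, X, Y, Z, hW, hX, hY, hZ, hWX, hWY, -, hXY, hXZ, hYZ, sWX, sYX, sYZ⟩
  obtain ⟨p₁, d₁⟩ := key W X hW hX hWX sWX
  obtain ⟨p₂, d₂⟩ := key Y X hY hX hXY.symm sYX
  obtain ⟨p₃, d₃⟩ := key Y Z hY hZ hYZ sYZ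
  by_cases hXT : X ∈ T
  · have hZT : Z ∈ T := by tauto
    have h₁ := hdist X hXT Z hZT hXZ
    have h₂ := card_symmDiff_le_add X Y Z
    rw [symmDiff_comm X Y] at h₂
    omega
  · have hWT : W ∈ T := by tauto
    have hYT : Y ∈ T := by tauto
    have h₁ := hdist W hWT Y hYT hWY
    have h₂ := card_symmDiff_le_add W X Y
    rw [symmDiff_comm X Y] at h₂
    omega

/-- For even positive `n` and `k = n/2`, for every constant-weight-`k`
SEC code `C`, there is an N-free family `F` with `|F| ≥ C(n,k) + |C|`. -/
theorem stmt_0 (n : ℕ) (hn : 0 < n) (hev : Even n) (k : ℕ) (hk : k = n / 2)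
    (C : Finset (Finset (Fin n))) (hC : IsSECCode k C) :
    ∃ F : Finset (Finset (Fin n)), IsNFree F ∧ n.choose k + C.card ≤ F.card := by
  obtain ⟨hCcard, hCdist⟩ := hC
  let a : Fin n := ⟨0, hn⟩
  have hT : ∀ t ∈ C.image (fun c => symmDiff c {a}), t.card = k + 1 ∨ t.card + 1 = k := by
    intro t ht
    obtain ⟨c, hc, rfl⟩ := Finset.mem_image.1 ht
    simpa only [hCcard c hc] using card_symmDiff_singleton c a
  have hinj : Function.Injective fun c : Finset (Fin n) => symmDiff c {a} :=
    symmDiff_left_injective {a}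
  refine ⟨Finset.powersetCard k Finset.univ ∪ C.image (fun c => symmDiff c {a}),
    isNFree_powersetCard_union hT ?_, ?_⟩
  · intro t₁ h₁ t₂ h₂ hne
    obtain ⟨c₁, hc₁, rfl⟩ := Finset.mem_image.1 h₁
    obtain ⟨c₂, hc₂, rfl⟩ := Finset.mem_image.1 h₂
    rw [symmDiff_symmDiff_symmDiff_comm, symmDiff_self, symmDiff_bot]
    exact hCdist c₁ hc₁ c₂ hc₂ fun h => hne (by rw [h])
  · rw [Finset.card_union_of_disjoint, Finset.card_powersetCard, Finset.card_univ,
      Fintype.card_fin, Finset.card_image_of_injective _ hinj]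
    refine Finset.disjoint_left.2 fun t ht ht' => ?_
    have h₁ := Finset.mem_powersetCard_univ.1 ht
    have h₂ := hT t ht'
    omega
end

section
/- Let n be an even positive integer, k = n/2, let i ∈ {1,...,n} be a fixed element, and let C be a constant-weight-k single-error-correcting code on {1,...,n}. Define C_up := {c ∪ {i} : c ∈ C, i ∉ c} and C_down := {c \ {i} : c ∈ C, i ∈ c}. Then the family F consisting of all k-element subsets of {1,...,n} together with C_up and C_down is N-free. -/
open Finset

/-- Two codewords sharing at least `k - 1` elements coincide. -/
lemma IsSECCode.eq_of_le_card_inter {α : Type*} [DecidableEq α] {k : ℕ} {C : Finset (Finset α)}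
    (hC : IsSECCode k C) {c d : Finset α} (hc : c ∈ C) (hd : d ∈ C)
    (h : k ≤ (c ∩ d).card + 1) : c = d := by
  by_contra hne
  have h4 := hC.2 c hc d hd hne
  have hle : (symmDiff c d).card ≤ (c \ d).card + (d \ c).card := card_union_le _ _
  have h1 := card_sdiff_add_card_inter c d
  have h2 := card_sdiff_add_card_inter d c
  rw [inter_comm] at h2
  have h3 := hC.1 c hc
  have h5 := hC.1 d hd
  omega

/-- Distinct sets `insert i c` and `insert i d` have no common subset of size `k`. -/
lemma IsSECCode.insert_eq_insert {α : Type*} [DecidableEq α] {k : ℕ} {C : Finset (Finset α)}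
    (hC : IsSECCode k C) {i : α} {c d Y : Finset α} (hc : c ∈ C) (hd : d ∈ C)
    (hY : Y.card = k) (hYc : Y ⊆ insert i c) (hYd : Y ⊆ insert i d) :
    insert i c = insert i d := by
  have hsub : Y ⊆ insert i (c ∩ d) := by
    rw [insert_inter_distrib]
    exact subset_inter hYc hYd
  have h := (card_le_card hsub).trans (card_insert_le i (c ∩ d))
  rw [hC.eq_of_le_card_inter hc hd (hY ▸ h)]

/-- Distinct sets `c.erase i` and `d.erase i` have no common superset of size `k`. -/
lemma IsSECCode.erase_eq_erase {α : Type*} [DecidableEq α] {k : ℕ} {C : Finset (Finset α)}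
    (hC : IsSECCode k C) {i : α} {c d X : Finset α} (hc : c ∈ C) (hd : d ∈ C)
    (hX : X.card = k) (hcX : c.erase i ⊆ X) (hdX : d.erase i ⊆ X) :
    c.erase i = d.erase i := by
  have hsub : c ∪ d ⊆ insert i X :=
    union_subset (subset_insert_iff.mpr hcX) (subset_insert_iff.mpr hdX)
  have h := (card_le_card hsub).trans (card_insert_le i X)
  have h1 := card_union_add_card_inter c d
  have h2 := hC.1 c hc
  have h3 := hC.1 d hd
  rw [hC.eq_of_le_card_inter hc hd (by omega)]

/-- A set `d.erase i` is never contained in `insert i c` when `i ∈ d` and `i ∉ c`. -/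
lemma IsSECCode.not_erase_subset_insert {α : Type*} [DecidableEq α] {k : ℕ}
    {C : Finset (Finset α)} (hC : IsSECCode k C) {i : α} {c d : Finset α} (hc : c ∈ C)
    (hd : d ∈ C) (hic : i ∉ c) (hid : i ∈ d) : ¬ d.erase i ⊆ insert i c := by
  intro h
  have hsub : d.erase i ⊆ c ∩ d := by
    intro x hx
    have := h hx
    grind
  have h1 := card_le_card hsub
  have h2 := card_erase_add_one hid
  have h3 := hC.1 d hd
  exact hic (hC.eq_of_le_card_inter hc hd (by omega) ▸ hid)

/-- With `n` even, `k = n/2`, a fixed `i`, and a constant-weight-`k`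
SEC code `C`, the family of all `k`-sets together with
`C_up = {c ∪ {i} : c ∈ C, i ∉ c}` and `C_down = {c \ {i} : c ∈ C, i ∈ c}`
is N-free. -/
theorem stmt_1 (n : ℕ) (hn : 0 < n) (hev : Even n) (k : ℕ) (hk : k = n / 2)
    (i : Fin n) (C : Finset (Finset (Fin n))) (hC : IsSECCode k C) :
    IsNFree ((Finset.powersetCard k (Finset.univ : Finset (Fin n))) ∪
      ((C.filter (fun c => i ∉ c)).image (fun c => insert i c)) ∪
      ((C.filter (fun c => i ∈ c)).image (fun c => c.erase i))) := by
  rintro ⟨W, X, Y, Z, hW, hX, hY, hZ, hWX, hWY, -, hXY, hXZ, hYZ, hWX', hYX', hYZ'⟩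
  have hWX_lt := card_lt_card (hWX'.ssubset_of_ne hWX)
  have hYX_lt := card_lt_card (hYX'.ssubset_of_ne hXY.symm)
  have hYZ_lt := card_lt_card (hYZ'.ssubset_of_ne hYZ)
  have hcases : ∀ S ∈ (powersetCard k (univ : Finset (Fin n))) ∪
      ((C.filter (fun c => i ∉ c)).image (fun c => insert i c)) ∪
      ((C.filter (fun c => i ∈ c)).image (fun c => c.erase i)),
      S.card = k ∨ (S.card = k + 1 ∧ ∃ c ∈ C, i ∉ c ∧ insert i c = S) ∨
        (S.card + 1 = k ∧ ∃ c ∈ C, i ∈ c ∧ c.erase i = S) := by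
    intro S hS
    simp only [mem_union, mem_powersetCard, mem_image, mem_filter] at hS
    rcases hS with (hS | ⟨c, ⟨hc, hic⟩, rfl⟩) | ⟨c, ⟨hc, hic⟩, rfl⟩
    · exact .inl hS.2
    · exact .inr (.inl ⟨by rw [card_insert_of_notMem hic, hC.1 c hc], c, hc, hic, rfl⟩)
    · exact .inr (.inr ⟨by rw [card_erase_add_one hic, hC.1 c hc], c, hc, hic, rfl⟩)
  rcases hcases X hX with hXk | ⟨hXk, c, hc, hic, rfl⟩ | ⟨hXk, -⟩
  · rcases hcases Y hY with hYk | ⟨hYk, -⟩ | ⟨-, d, hd, -, rfl⟩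
    · omega
    · omega
    rcases hcases W hW with hWk | ⟨hWk, -⟩ | ⟨-, e, he, -, rfl⟩
    · omega
    · omega
    exact hWY (hC.erase_eq_erase he hd hXk hWX' hYX')
  · rcases hcases Y hY with hYk | ⟨hYk, -⟩ | ⟨-, d, hd, hid, rfl⟩
    · rcases hcases Z hZ with hZk | ⟨-, e, he, -, rfl⟩ | ⟨hZk, -⟩
      · omega
      · exact hXZ (hC.insert_eq_insert hc he hYk hYX' hYZ')
      · omega
    · omega
    · exact hC.not_erase_subset_insert hc hd hic hid hYX'
  · rcases hcases Y hY with hYk | ⟨hYk, -⟩ | ⟨hYk, -⟩ <;> omega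
end

section
/- Let n be a positive integer and k = ⌊n/2⌋. For every family C of (k+1)-element subsets of {1,...,n} such that any two distinct members of C have symmetric difference of size at least 4, the family F consisting of all k-element subsets of {1,...,n} together with C is N-free and satisfies |F| = C(n,k) + |C|. (In particular, La(n,N) ≥ C(n,k) + A(n,4,k+1).) -/
/-- Two distinct supersets of a common `k`-set cannot both lie in a weight-`(k+1)` SEC code. -/
theorem IsSECCode.eq_of_subset {α : Type*} [DecidableEq α] {k : ℕ} {C : Finset (Finset α)}
    (hC : IsSECCode (k + 1) C) {X Y Z : Finset α} (hX : X ∈ C) (hZ : Z ∈ C)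
    (hY : Y.card = k) (hYX : Y ⊆ X) (hYZ : Y ⊆ Z) : X = Z := by
  by_contra hne
  have hdist := hC.2 X hX Z hZ hne
  have hsub : symmDiff X Z ⊆ X \ Y ∪ Z \ Y := by
    intro a ha
    simp only [Finset.mem_symmDiff, Finset.mem_union, Finset.mem_sdiff] at ha ⊢
    have := @hYX a
    have := @hYZ a
    tauto
  have hle := (Finset.card_le_card hsub).trans (Finset.card_union_le _ _)
  rw [Finset.card_sdiff_of_subset hYX, Finset.card_sdiff_of_subset hYZ,
    hC.1 X hX, hC.1 Z hZ, hY] at hle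
  omega

/-- A strict inclusion among `k`-sets and members of a weight-`(k+1)` code goes from a `k`-set
to a code member. -/
theorem IsSECCode.card_eq_and_mem_of_ssubset {α : Type*} [Fintype α] [DecidableEq α] {k : ℕ}
    {C : Finset (Finset α)} (hC : IsSECCode (k + 1) C) {X Y : Finset α}
    (hY : Y ∈ Finset.powersetCard k Finset.univ ∪ C)
    (hX : X ∈ Finset.powersetCard k Finset.univ ∪ C) (hYX : Y ⊂ X) :
    Y.card = k ∧ X ∈ C := by
  have hlt := Finset.card_lt_card hYX
  simp only [Finset.mem_union, Finset.mem_powersetCard_univ] at hX hY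
  rcases hX with hX | hX <;> rcases hY with hY | hY
  · omega
  · have := hC.1 Y hY
    omega
  · exact ⟨hY, hX⟩
  · have := hC.1 Y hY
    have := hC.1 X hX
    omega

/-- For `k = ⌊n/2⌋` and any constant-weight-`(k+1)` SEC code `C`,
all `k`-sets together with `C` form an N-free family of size `C(n,k) + |C|`. -/
theorem stmt_6 (n : ℕ) (hn : 0 < n) (k : ℕ) (hk : k = n / 2)
    (C : Finset (Finset (Fin n))) (hC : IsSECCode (k + 1) C) :
    IsNFree ((Finset.powersetCard k (Finset.univ : Finset (Fin n))) ∪ C) ∧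
    ((Finset.powersetCard k (Finset.univ : Finset (Fin n))) ∪ C).card =
      n.choose k + C.card := by
  constructor
  · rintro ⟨W, X, Y, Z, -, hX, hY, hZ, -, -, -, hXY, hXZ, hYZ, -, hYX, hYZ'⟩
    obtain ⟨hYk, hXC⟩ := hC.card_eq_and_mem_of_ssubset hY hX (hYX.ssubset_of_ne hXY.symm)
    obtain ⟨-, hZC⟩ := hC.card_eq_and_mem_of_ssubset hY hZ (hYZ'.ssubset_of_ne hYZ)
    exact hXZ (hC.eq_of_subset hXC hZC hYk hYX hYZ')
  · rw [Finset.card_union_of_disjoint, Finset.card_powersetCard, Finset.card_univ,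
      Fintype.card_fin]
    rw [Finset.disjoint_left]
    intro c hc hcC
    have := hC.1 c hcC
    rw [Finset.mem_powersetCard_univ] at hc
    omega
end

section
/- Let n be a positive integer and k = ⌊n/2⌋. For every family C of (k+1)-element subsets of {1,...,n} such that any two distinct members of C have symmetric difference of size at least 4, the family F consisting of all k-element subsets of {1,...,n} together with C is V-free. -/
/-- A family is V-free if there are no three distinct sets `X, Y, Z` in it
with `Y ⊆ X` and `Y ⊆ Z`. -/
def IsVFree {α : Type*} (F : Finset (Finset α)) : Prop :=
  ¬ ∃ X Y Z : Finset α, X ∈ F ∧ Y ∈ F ∧ Z ∈ F ∧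
    X ≠ Y ∧ X ≠ Z ∧ Y ≠ Z ∧ Y ⊆ X ∧ Y ⊆ Z

/-- For `k = ⌊n/2⌋` and any constant-weight-`(k+1)` SEC code `C`,
all `k`-sets together with `C` form a V-free family. -/
theorem stmt_7 (n : ℕ) (hn : 0 < n) (k : ℕ) (hk : k = n / 2)
    (C : Finset (Finset (Fin n))) (hC : IsSECCode (k + 1) C) :
    IsVFree ((Finset.powersetCard k (Finset.univ : Finset (Fin n))) ∪ C) := by
  obtain ⟨hcard, hdist⟩ := hC
  rintro ⟨X, Y, Z, hX, hY, hZ, hXY, hXZ, hYZ, hYX, hYZs⟩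
  have hltX := Finset.card_lt_card (hYX.ssubset_of_ne hXY.symm)
  have hltZ := Finset.card_lt_card (hYZs.ssubset_of_ne hYZ)
  simp only [Finset.mem_union, Finset.mem_powersetCard_univ] at hX hY hZ
  have hYk : k ≤ Y.card := by
    rcases hY with h | h
    · exact h.ge
    · exact (hcard Y h).symm ▸ k.le_succ
  have hXC : X ∈ C := hX.resolve_left (by omega)
  have hZC : Z ∈ C := hZ.resolve_left (by omega)
  have hdistXZ := hdist X hXC Z hZC hXZ
  have hsub : symmDiff X Z ⊆ (X \ Y) ∪ (Z \ Y) := by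
    intro a
    simp only [Finset.mem_symmDiff, Finset.mem_union, Finset.mem_sdiff]
    rintro (⟨ha, hna⟩ | ⟨ha, hna⟩)
    · exact Or.inl ⟨ha, fun h => hna (hYZs h)⟩
    · exact Or.inr ⟨ha, fun h => hna (hYX h)⟩
  have hle := (Finset.card_le_card hsub).trans (Finset.card_union_le _ _)
  rw [Finset.card_sdiff_of_subset hYX, Finset.card_sdiff_of_subset hYZs,
    hcard X hXC, hcard Z hZC] at hle
  omega
end

section
/- (Graham–Sloane) For all positive integers n and all 0 ≤ k ≤ n, there exists a family C of k-element subsets of {1,...,n} such that any two distinct members of C have symmetric difference of size at least 4 and |C| ≥ C(n,k)/n. That is, A(n,4,k) ≥ (1/n)·C(n,k). -/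
/-- The `k`-subsets of an additive commutative group with a prescribed sum of elements form a
single-error-correcting code. -/
theorem isSECCode_filter_sum_eq {G : Type*} [AddCommGroup G] [Fintype G] [DecidableEq G]
    (k : ℕ) (g : G) :
    IsSECCode k ((Finset.powersetCard k (Finset.univ : Finset G)).filter
      fun s => ∑ x ∈ s, x = g) := by
  refine ⟨fun c hc => (Finset.mem_powersetCard.1 (Finset.mem_filter.1 hc).1).2, ?_⟩
  intro s hs t ht hne
  simp only [Finset.mem_filter, Finset.mem_powersetCard, Finset.subset_univ, true_and] at hs ht
  have hcomm : (s \ t).card = (t \ s).card := Finset.card_sdiff_comm (hs.1.trans ht.1.symm)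
  have hsymm : (symmDiff s t).card = (s \ t).card + (t \ s).card :=
    Finset.card_union_of_disjoint disjoint_sdiff_sdiff
  have hpos : (s \ t).card ≠ 0 := fun h =>
    hne (Finset.eq_of_subset_of_card_le (Finset.sdiff_eq_empty_iff_subset.1
      (Finset.card_eq_zero.1 h)) (ht.1.trans hs.1.symm).le)
  by_contra hlt
  obtain ⟨a, ha⟩ := Finset.card_eq_one.1 (show (s \ t).card = 1 by lia)
  obtain ⟨b, hb⟩ := Finset.card_eq_one.1 (show (t \ s).card = 1 by lia)
  have hsum : ∑ x ∈ s \ t, x = ∑ x ∈ t \ s, x := by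
    have h₁ := Finset.sum_inter_add_sum_sdiff s t (fun x : G => x)
    have h₂ := Finset.sum_inter_add_sum_sdiff t s (fun x : G => x)
    rw [Finset.inter_comm t s] at h₂
    exact add_left_cancel (h₁.trans (hs.2.trans (ht.2.symm.trans h₂.symm)))
  have hab : a = b := by simpa [ha, hb] using hsum
  have has : a ∈ s \ t := by simp [ha]
  have hbt : b ∈ t \ s := by simp [hb]
  exact (Finset.mem_sdiff.1 hbt).2 (hab ▸ (Finset.mem_sdiff.1 has).1)

/-- Graham–Sloane: `A(n,4,k) ≥ C(n,k)/n`, i.e. there is a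
constant-weight-`k` SEC code of size at least `C(n,k)/n`. -/
theorem stmt_9 (n k : ℕ) (hn : 0 < n) (hk : k ≤ n) :
    ∃ C : Finset (Finset (Fin n)), IsSECCode k C ∧
      (n.choose k : ℝ) / n ≤ (C.card : ℝ) := by
  have : NeZero n := ⟨hn.ne'⟩
  obtain ⟨g, -, hg⟩ := Finset.exists_le_card_fiber_of_nsmul_le_card_of_maps_to
    (s := Finset.powersetCard k (Finset.univ : Finset (Fin n))) (t := Finset.univ)
    (f := fun s => ∑ x ∈ s, x) (b := (n.choose k : ℝ) / n)
    (fun _ _ => Finset.mem_univ _) Finset.univ_nonempty (by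
      have hn₀ : (n : ℝ) ≠ 0 := Nat.cast_ne_zero.2 hn.ne'
      simp [mul_div_cancel₀ _ hn₀])
  exact ⟨_, isSECCode_filter_sum_eq k g, hg⟩
end

section
/- Let n and k be positive integers with k ≤ n, and let t be an integer. Then the family C_t of all k-element subsets c of {1,...,n} whose element sum is congruent to t modulo n has the property that any two distinct members of C_t have symmetric difference of size at least 4; moreover, there exists some residue t for which |C_t| ≥ C(n,k)/n. -/
/-- The family `C_t` of all `k`-element subsets of `{1,...,n}` whose element sum
is congruent to `t` modulo `n`. -/
def Cfam (n k : ℕ) (t : ℤ) : Finset (Finset ℕ) :=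
  (Finset.powersetCard k (Finset.Icc 1 n)).filter
    (fun c => (∑ j ∈ c, (j : ℤ)) % (n : ℤ) = t % (n : ℤ))

/-- If `c` and `d` differ by exchanging one element `a` for `b`, with `a, b` in `{1,...,n}` and
sums congruent modulo `n`, then `a = b`. -/
theorem eq_of_sdiff_eq_singleton_of_sum_emod_eq {n : ℕ} {c d : Finset ℕ} {a b : ℕ}
    (hc : c ⊆ Finset.Icc 1 n) (hd : d ⊆ Finset.Icc 1 n)
    (ha : c \ d = {a}) (hb : d \ c = {b})
    (h : (∑ j ∈ c, (j : ℤ)) % (n : ℤ) = (∑ j ∈ d, (j : ℤ)) % (n : ℤ)) : a = b := by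
  have hsc := Finset.sum_inter_add_sum_sdiff c d (fun j => (j : ℤ))
  have hsd := Finset.sum_inter_add_sum_sdiff d c (fun j => (j : ℤ))
  rw [ha, Finset.sum_singleton] at hsc
  rw [hb, Finset.sum_singleton, Finset.inter_comm] at hsd
  have han := Finset.mem_Icc.1 (hc (Finset.mem_sdiff.1 (ha ▸ Finset.mem_singleton_self a)).1)
  have hbn := Finset.mem_Icc.1 (hd (Finset.mem_sdiff.1 (hb ▸ Finset.mem_singleton_self b)).1)
  have hdvd : (n : ℤ) ∣ (a : ℤ) - b := by
    have := Int.dvd_of_emod_eq_zero (Int.emod_eq_emod_iff_emod_sub_eq_zero.1 h)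
    rwa [← hsc, ← hsd, add_sub_add_left_eq_sub] at this
  have := Int.eq_zero_of_abs_lt_dvd hdvd (abs_lt.2 ⟨by omega, by omega⟩)
  omega

/-- Any two distinct members of `C_t` have symmetric difference of
size at least 4, and some residue class `t` satisfies `|C_t| ≥ C(n,k)/n`. -/
theorem stmt_10 (n k : ℕ) (hn : 0 < n) (hk0 : 0 < k) (hk : k ≤ n) (t : ℤ) :
    (∀ c₁ ∈ Cfam n k t, ∀ c₂ ∈ Cfam n k t, c₁ ≠ c₂ → 4 ≤ (symmDiff c₁ c₂).card) ∧
    ∃ t' : ℤ, (n.choose k : ℝ) / n ≤ ((Cfam n k t').card : ℝ) := by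
  constructor
  · intro c₁ h₁ c₂ h₂ hne
    simp only [Cfam, Finset.mem_filter, Finset.mem_powersetCard] at h₁ h₂
    obtain ⟨⟨hs₁, hc₁⟩, hm₁⟩ := h₁
    obtain ⟨⟨hs₂, hc₂⟩, hm₂⟩ := h₂
    by_contra! hlt
    have hcard : (c₁ \ c₂).card = (c₂ \ c₁).card :=
      Finset.card_sdiff_comm (hc₁.trans hc₂.symm)
    have hsymm : (symmDiff c₁ c₂).card = (c₁ \ c₂).card + (c₂ \ c₁).card :=
      Finset.card_union_of_disjoint disjoint_sdiff_sdiff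
    have hpos : (c₁ \ c₂).card ≠ 0 := fun h0 =>
      hne (Finset.eq_of_subset_of_card_le
        (Finset.sdiff_eq_empty_iff_subset.1 (Finset.card_eq_zero.1 h0)) (hc₂.trans hc₁.symm).le)
    obtain ⟨a, ha⟩ := Finset.card_eq_one.1 (show (c₁ \ c₂).card = 1 by omega)
    obtain ⟨b, hb⟩ := Finset.card_eq_one.1 (show (c₂ \ c₁).card = 1 by omega)
    have hab := eq_of_sdiff_eq_singleton_of_sum_emod_eq hs₁ hs₂ ha hb (hm₁.trans hm₂.symm)
    have ha' : a ∈ c₁ \ c₂ := ha ▸ Finset.mem_singleton_self a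
    have hb' : b ∈ c₂ \ c₁ := hb ▸ Finset.mem_singleton_self b
    rw [← hab] at hb'
    exact (Finset.mem_sdiff.1 ha').2 (Finset.mem_sdiff.1 hb').1
  · have hn' : (0 : ℤ) < n := by exact_mod_cast hn
    obtain ⟨r, hr, hle⟩ := Finset.exists_le_card_fiber_of_nsmul_le_card_of_maps_to
      (s := Finset.powersetCard k (Finset.Icc 1 n)) (t := Finset.Ico (0 : ℤ) n)
      (f := fun c => (∑ j ∈ c, (j : ℤ)) % (n : ℤ)) (b := (n.choose k : ℝ) / n)
      (fun c _ => Finset.mem_Ico.2 ⟨Int.emod_nonneg _ hn'.ne', Int.emod_lt_of_pos _ hn'⟩)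
      ⟨0, Finset.mem_Ico.2 ⟨le_rfl, hn'⟩⟩
      (by
        have : (n : ℝ) ≠ 0 := by exact_mod_cast hn.ne'
        simp [mul_div_cancel₀, this])
    obtain ⟨hr0, hrn⟩ := Finset.mem_Ico.1 hr
    refine ⟨r, ?_⟩
    rwa [Cfam, Int.emod_eq_of_lt hr0 hrn]
end

section
/- For every positive integer n with ⌊n/2⌋+1 ≤ n, there exists an N-free family F of subsets of {1,...,n} with |F| ≥ C(n,⌊n/2⌋) + (1/n)·C(n,⌊n/2⌋+1). (This yields the lower bound La(n,N) ≥ C(n,⌊n/2⌋)·(1 + 1/n + Ω(1/n²)).) -/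
/-- In an abelian group, two finite sets of size `k + 1` with the same sum which share a
`k`-subset are equal. -/
theorem Finset.eq_of_common_subset_of_sum_eq {G : Type*} [AddCommGroup G] [DecidableEq G] {k : ℕ}
    {X Y Z : Finset G} (hX : X.card = k + 1) (hY : Y.card = k) (hZ : Z.card = k + 1)
    (hYX : Y ⊆ X) (hYZ : Y ⊆ Z) (hsum : ∑ x ∈ X, x = ∑ z ∈ Z, z) : X = Z := by
  obtain ⟨a, ha⟩ : ∃ a, X \ Y = {a} := by
    rw [← Finset.card_eq_one, Finset.card_sdiff_of_subset hYX]
    omega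
  obtain ⟨b, hb⟩ : ∃ b, Z \ Y = {b} := by
    rw [← Finset.card_eq_one, Finset.card_sdiff_of_subset hYZ]
    omega
  rw [← Finset.sum_sdiff hYX, ← Finset.sum_sdiff hYZ, ha, hb, Finset.sum_singleton,
    Finset.sum_singleton, add_left_inj] at hsum
  rw [← Finset.sdiff_union_of_subset hYX, ← Finset.sdiff_union_of_subset hYZ, ha, hb, hsum]

/-- A family of sets of sizes `k` and `k + 1`, in which no two sets of size `k + 1` share a member
of size `k`, is N-free. -/
theorem isNFree_of_two_levels {α : Type*} {k : ℕ} {F : Finset (Finset α)}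
    (hF : ∀ S ∈ F, S.card = k ∨ S.card = k + 1)
    (hsep : ∀ X ∈ F, ∀ Y ∈ F, ∀ Z ∈ F, X.card = k + 1 → Y.card = k → Z.card = k + 1 →
      Y ⊆ X → Y ⊆ Z → X = Z) : IsNFree F := by
  rintro ⟨W, X, Y, Z, -, hX, hY, hZ, -, -, -, hXY, hXZ, hYZ, -, hYX, hYZ'⟩
  have h₁ := Finset.card_lt_card (hYX.ssubset_of_ne hXY.symm)
  have h₂ := Finset.card_lt_card (hYZ'.ssubset_of_ne hYZ)
  have cX := hF X hX
  have cY := hF Y hY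
  have cZ := hF Z hZ
  exact hXZ (hsep X hX Y hY Z hZ (by omega) (by omega) (by omega) hYX hYZ')

/-- The subsets of a finite abelian group `G` contain an N-free family consisting of all `k`-sets
and at least a `1 / |G|` proportion of the `(k + 1)`-sets. -/
theorem exists_isNFree_card_ge {G : Type*} [AddCommGroup G] [Fintype G] [DecidableEq G] (k : ℕ) :
    ∃ F : Finset (Finset G), IsNFree F ∧
      ((Fintype.card G).choose k : ℝ) + ((Fintype.card G).choose (k + 1) : ℝ) / Fintype.card G
        ≤ (F.card : ℝ) := by
  have hG : (0 : ℝ) < Fintype.card G := by exact_mod_cast Fintype.card_pos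
  obtain ⟨g, -, hg⟩ := Finset.exists_le_card_fiber_of_nsmul_le_card_of_maps_to
    (s := Finset.powersetCard (k + 1) (Finset.univ : Finset G)) (t := Finset.univ)
    (f := fun S => ∑ x ∈ S, x)
    (b := ((Fintype.card G).choose (k + 1) : ℝ) / Fintype.card G)
    (fun _ _ => Finset.mem_univ _) Finset.univ_nonempty (by
      rw [Finset.card_powersetCard, Finset.card_univ, nsmul_eq_mul, mul_div_cancel₀ _ hG.ne'])
  set C := (Finset.powersetCard (k + 1) (Finset.univ : Finset G)).filter
    fun S => ∑ x ∈ S, x = g with hC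
  have mem_C {S : Finset G} : S ∈ C ↔ S.card = k + 1 ∧ ∑ x ∈ S, x = g := by
    simp [hC, Finset.mem_powersetCard]
  have mem_level {S : Finset G} : S ∈ Finset.powersetCard k Finset.univ ↔ S.card = k := by
    simp [Finset.mem_powersetCard]
  refine ⟨Finset.powersetCard k Finset.univ ∪ C, isNFree_of_two_levels (k := k) ?_ ?_, ?_⟩
  · intro S hS
    rw [Finset.mem_union, mem_C, mem_level] at hS
    exact hS.imp id And.left
  · intro X hX Y _ Z hZ cX cY cZ hYX hYZ
    rw [Finset.mem_union, mem_C, mem_level] at hX hZ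
    have sX := (hX.resolve_left (by omega)).2
    have sZ := (hZ.resolve_left (by omega)).2
    exact Finset.eq_of_common_subset_of_sum_eq cX cY cZ hYX hYZ (sX.trans sZ.symm)
  · have hdisj : Disjoint (Finset.powersetCard k Finset.univ) C := by
      rw [Finset.disjoint_left]
      intro S hS hS'
      rw [mem_level] at hS
      rw [mem_C] at hS'
      omega
    rw [Finset.card_union_of_disjoint hdisj, Finset.card_powersetCard, Finset.card_univ,
      Nat.cast_add]
    gcongr

/-- There is an N-free family of size at least
`C(n,⌊n/2⌋) + C(n,⌊n/2⌋+1)/n`. -/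
theorem stmt_11 (n : ℕ) (hn : 0 < n) (h : n / 2 + 1 ≤ n) :
    ∃ F : Finset (Finset (Fin n)), IsNFree F ∧
      (n.choose (n / 2) : ℝ) + (n.choose (n / 2 + 1) : ℝ) / n ≤ (F.card : ℝ) := by
  have : NeZero n := ⟨hn.ne'⟩
  simpa only [Fintype.card_fin] using exists_isNFree_card_ge (G := Fin n) (n / 2)
end

section
/- (Griggs–Katona, upper bound) There exists a constant c > 0 such that for every positive integer n, every N-free family F of subsets of {1,...,n} satisfies |F| ≤ C(n,⌊n/2⌋)·(1 + 2/n + c/n²). -/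
open Finset Nat

/-- The comparability graph of an N-free family contains no path on four vertices. -/
lemma IsNFree.not_path {α : Type*} {F : Finset (Finset α)} (hF : IsNFree F)
    {x u v y : Finset α} (hx : x ∈ F) (hu : u ∈ F) (hv : v ∈ F) (hy : y ∈ F)
    (hxv : x ≠ v) (hxy : x ≠ y) (huy : u ≠ y)
    (hxu : x ⊂ u ∨ u ⊂ x) (huv : u ⊂ v ∨ v ⊂ u) (hvy : v ⊂ y ∨ y ⊂ v) : False := by
  have key : ∀ W X Y Z : Finset α, W ∈ F → X ∈ F → Y ∈ F → Z ∈ F → W ≠ X → W ≠ Y → W ≠ Z →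
      X ≠ Y → X ≠ Z → Y ≠ Z → W ⊆ X → Y ⊆ X → Y ⊆ Z → False :=
    fun W X Y Z h1 h2 h3 h4 h5 h6 h7 h8 h9 h10 h11 h12 h13 =>
      hF ⟨W, X, Y, Z, h1, h2, h3, h4, h5, h6, h7, h8, h9, h10, h11, h12, h13⟩
  have nxu : x ≠ u := by rintro rfl; simp at hxu
  have nuv : u ≠ v := by rintro rfl; simp at huv
  have nvy : v ≠ y := by rintro rfl; simp at hvy
  rcases hxu with h1 | h1 <;> rcases huv with h2 | h2 <;> rcases hvy with h3 | h3
  · exact key u v x y hu hv hx hy nuv nxu.symm huy hxv.symm nvy hxy h2.subset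
      (h1.trans h2).subset ((h1.trans h2).trans h3).subset
  · exact key y v x u hy hv hx hu nvy.symm hxy.symm huy.symm hxv.symm nuv.symm nxu h3.subset
      (h1.trans h2).subset h1.subset
  · exact key x u v y hx hu hv hy nxu hxv hxy nuv huy nvy h1.subset h2.subset h3.subset
  · exact key x u y v hx hu hy hv nxu hxy hxv huy nuv nvy.symm h1.subset (h3.trans h2).subset
      h3.subset
  · exact key v y u x hv hy hu hx nvy nuv.symm hxv.symm huy.symm hxy.symm nxu.symm h3.subset
      (h2.trans h3).subset h1.subset
  · exact key y v u x hy hv hu hx nvy.symm huy.symm hxy.symm nuv.symm hxv.symm nxu.symm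
      h3.subset h2.subset h1.subset
  · exact key u x v y hu hx hv hy nxu.symm nuv huy hxv hxy nvy h1.subset (h2.trans h1).subset
      h3.subset
  · exact key v x y u hv hx hy hu hxv.symm nvy nuv.symm hxy nxu huy.symm (h2.trans h1).subset
      ((h3.trans h2).trans h1).subset (h3.trans h2).subset

/-- In an N-free family every set can be assigned a partner such that of any two comparable
members one is the partner of the other: the components of the comparability graph are stars and
triangles. -/
lemma IsNFree.exists_partner {α : Type*} {F : Finset (Finset α)} (hF : IsNFree F) :
    ∃ p : Finset α → Option (Finset α), (∀ A B, p A = some B → B ∈ F ∧ A ≠ B) ∧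
      ∀ u ∈ F, ∀ v ∈ F, u ⊂ v → p u = some v ∨ p v = some u := by
  classical
  let Q : Finset α → Finset α → Prop := fun A B => B ∈ F ∧ (A ⊂ B ∨ B ⊂ A) ∧
    ((∃ C ∈ F, A ⊂ B ∧ B ⊂ C) ∨ (∃ C ∈ F, C ⊂ A ∧ A ⊂ B) ∨ (∃ C ∈ F, B ⊂ C ∧ C ⊂ A) ∨
      ¬ ∃ C ∈ F, ∃ D ∈ F, (A ⊂ C ∨ C ⊂ A) ∧ (A ⊂ D ∨ D ⊂ A) ∧ C ⊂ D)
  let p : Finset α → Option (Finset α) := fun A => if h : ∃ B, Q A B then some h.choose else none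
  have hp : ∀ A B, p A = some B → Q A B := by
    intro A B h
    by_cases hQ : ∃ B, Q A B
    · have h' : hQ.choose = B := by simpa [p, hQ] using h
      exact h' ▸ hQ.choose_spec
    · simp [p, hQ] at h
  have hp' : ∀ A B, Q A B → (∀ B', Q A B' → B' = B) → p A = some B := by
    intro A B h h'
    have hQ : ∃ B, Q A B := ⟨B, h⟩
    simp only [p, hQ, dite_true]
    exact congrArg some (h' _ hQ.choose_spec)
  -- a vertex of a triangle has no neighbours outside the triangle
  have tri : ∀ a ∈ F, ∀ b ∈ F, ∀ c ∈ F, (a ⊂ b ∨ b ⊂ a) → (b ⊂ c ∨ c ⊂ b) → (c ⊂ a ∨ a ⊂ c) →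
      ∀ d ∈ F, (a ⊂ d ∨ d ⊂ a) → d = b ∨ d = c := by
    intro a ha b hb c hc hab hbc hca d hd had
    by_contra! h
    have nca : c ≠ a := by rintro rfl; simp at hca
    have nda : d ≠ a := by rintro rfl; simp at had
    exact hF.not_path hd ha hb hc h.1 h.2 nca.symm had.symm hab hbc
  refine ⟨p, ?_, ?_⟩
  · intro A B h
    obtain ⟨hB, hAB, -⟩ := hp A B h
    refine ⟨hB, ?_⟩
    rintro rfl
    simp at hAB
  intro u hu v hv huv
  by_cases hno : ∃ w ∈ F, (w ⊂ u ∨ u ⊂ w) ∧ (w ⊂ v ∨ v ⊂ w)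
  · obtain ⟨w, hwF, hwu, hwv⟩ := hno
    -- in a chain `a ⊂ b ⊂ c` the partners are `a ↦ b ↦ c ↦ a`
    have chain : ∀ a ∈ F, ∀ b ∈ F, ∀ c ∈ F, a ⊂ b → b ⊂ c →
        p a = some b ∧ p b = some c ∧ p c = some a := by
      intro a ha b hb c hc hab hbc
      have hac := hab.trans hbc
      have nba : ¬ b ⊂ a := hab.asymm
      have ncb : ¬ c ⊂ b := hbc.asymm
      have nca : ¬ c ⊂ a := hac.asymm
      have ta := tri a ha b hb c hc (.inl hab) (.inl hbc) (.inr hac)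
      have tb := tri b hb c hc a ha (.inl hbc) (.inr hac) (.inl hab)
      have tc := tri c hc a ha b hb (.inr hac) (.inl hab) (.inl hbc)
      refine ⟨hp' a b ⟨hb, .inl hab, .inl ⟨c, hc, hab, hbc⟩⟩ ?_,
        hp' b c ⟨hc, .inl hbc, .inr (.inl ⟨a, ha, hab, hbc⟩)⟩ ?_,
        hp' c a ⟨ha, .inr hac, .inr (.inr (.inl ⟨b, hb, hab, hbc⟩))⟩ ?_⟩
      · rintro B ⟨hB, haB, hQ⟩
        rcases ta B hB haB with rfl | rfl
        · rfl
        rcases hQ with ⟨C, hC, -, h⟩ | ⟨C, hC, h, -⟩ | ⟨C, hC, h, h'⟩ | h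
        · rcases tc C hC (.inl h) with rfl | rfl
          exacts [(nca h).elim, (ncb h).elim]
        · rcases ta C hC (.inr h) with rfl | rfl
          exacts [(nba h).elim, (nca h).elim]
        · exact (nca (h.trans h')).elim
        · exact (h ⟨b, hb, B, hc, .inl hab, .inl hac, hbc⟩).elim
      · rintro B ⟨hB, haB, hQ⟩
        rcases tb B hB haB with rfl | rfl
        · rfl
        rcases hQ with ⟨C, hC, h, -⟩ | ⟨C, hC, -, h⟩ | ⟨C, hC, h, h'⟩ | h
        · exact (nba h).elim
        · exact (nba h).elim
        · rcases tb C hC (.inr h') with rfl | rfl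
          exacts [(ncb h').elim, (ssubset_irrefl _ h).elim]
        · exact (h ⟨B, ha, c, hc, .inr hab, .inl hbc, hac⟩).elim
      · rintro B ⟨hB, haB, hQ⟩
        rcases tc B hB haB with rfl | rfl
        · rfl
        rcases hQ with ⟨C, hC, h, -⟩ | ⟨C, hC, -, h⟩ | ⟨C, hC, h, h'⟩ | h
        · exact (ncb h).elim
        · exact (ncb h).elim
        · rcases tc C hC (.inr h') with rfl | rfl
          exacts [(nba h).elim, (ssubset_irrefl _ h).elim]
        · exact (h ⟨a, ha, B, hb, .inr hac, .inr hbc, hab⟩).elim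
    rcases hwu with h1 | h1
    · exact .inl (chain w hwF u hu v hv h1 huv).2.1
    · rcases hwv with h2 | h2
      · exact .inr (chain u hu w hwF v hv h1 h2).2.2
      · exact .inl (chain u hu v hv w hwF huv h2).1
  · have no_triangle : ∀ a ∈ F, ∀ b ∈ F, (a ⊂ b ∨ b ⊂ a) →
        (∀ w ∈ F, ¬ ((a ⊂ w ∨ w ⊂ a) ∧ (b ⊂ w ∨ w ⊂ b))) → Q a b := by
      intro a ha b hb hab hno
      refine ⟨hb, hab, .inr (.inr (.inr ?_))⟩
      rintro ⟨C, hC, D, hD, haC, haD, hCD⟩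
      rcases tri a ha C hC D hD haC (.inl hCD) haD.symm b hb hab with rfl | rfl
      · exact hno D hD ⟨haD, .inl hCD⟩
      · exact hno C hC ⟨haC, .inr hCD⟩
    have hQu := no_triangle u hu v hv (.inl huv) fun w hw h => hno ⟨w, hw, h.1.symm, h.2.symm⟩
    have hQv := no_triangle v hv u hu (.inr huv) fun w hw h => hno ⟨w, hw, h.2.symm, h.1.symm⟩
    by_contra! h
    obtain ⟨x, hx, hxv⟩ : ∃ x, Q u x ∧ x ≠ v := by
      by_contra! h'
      exact h.1 (hp' u v hQu h')
    obtain ⟨y, hy, hyu⟩ : ∃ y, Q v y ∧ y ≠ u := by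
      by_contra! h'
      exact h.2 (hp' v u hQv h')
    refine hF.not_path hx.1 hu hv hy.1 hxv ?_ hyu.symm hx.2.1.symm (.inl huv) hy.2.1
    rintro rfl
    exact hno ⟨x, hx.1, hx.2.1.symm, hy.2.1.symm⟩

namespace Numbering

variable {X : Type*} [Fintype X] [DecidableEq X]

lemma card_prefixed_inter_prefixed_le {s t : Finset X} (hst : s ⊆ t) :
    #(prefixed s ∩ prefixed t) ≤ (#s)! * ((#t - #s)! * (Fintype.card X - #t)!) := by
  have hcard : #(t.subtype (· ∈ sᶜ)) = #t - #s := by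
    rw [card_subtype, ← card_sdiff_of_subset hst]
    congr 1
    ext x
    simp
  have hle : Fintype.card ↥sᶜ - (#t - #s) = Fintype.card X - #t := by
    have := card_le_card hst
    have := t.card_le_univ
    simp
    omega
  have h : #(prefixed s ∩ prefixed t) ≤
      #((univ : Finset (Numbering s)) ×ˢ prefixed (t.subtype (· ∈ sᶜ))) := by
    refine card_le_card_of_injOn
      (fun f => if hf : f ∈ prefixed s then prefixedEquiv s ⟨f, hf⟩ else
        (Fintype.equivFin _, Fintype.equivFin _)) ?_ ?_
    · intro f hf
      obtain ⟨hs, ht⟩ := mem_inter.1 (mem_coe.1 hf)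
      simp only [hs, dite_true, coe_product, Set.mem_prod, mem_coe, mem_univ, true_and, mem_prefixed]
      intro x
      have hx := (mem_prefixed.1 hs x).not.1 (mem_compl.1 x.2)
      have := card_le_card hst
      rw [hcard, mem_subtype, mem_prefixed.1 ht x]
      change _ ↔ (f x : ℕ) - #s < _
      omega
    · intro f hf g hg hfg
      have hs := (mem_inter.1 (mem_coe.1 hf)).1
      have hs' := (mem_inter.1 (mem_coe.1 hg)).1
      simpa [hs, hs', -mem_prefixed] using hfg
  refine h.trans ?_
  rw [card_product, card_prefixed, hcard, hle, Finset.card_univ, Fintype.card_numbering, Fintype.card_coe]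

end Numbering

lemma Nat.le_choose_self {m k : ℕ} (hk : 1 ≤ k) (hkm : k < m) : m ≤ m.choose k := by
  induction m generalizing k with
  | zero => omega
  | succ m ih =>
    obtain ⟨k, rfl⟩ := Nat.exists_eq_add_of_le' hk
    rw [choose_succ_succ']
    have h1 : 0 < m.choose k := choose_pos (by omega)
    rcases (show k + 1 < m ∨ m = k + 1 by omega) with h | rfl
    · have := ih (k := k + 1) (by omega) h
      omega
    · simp

/-- Near the middle level `choose n k` is at most `choose n (n / 2)`, and away from it there is
room for the factor `k / (k - 1)`. -/
lemma Nat.choose_le_middle_mul {n k : ℕ} (hn : 8 ≤ n) (hk : 2 ≤ k) :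
    (n.choose k : ℝ) ≤
      (1 - 1 / k) * (n.choose (n / 2) * (1 + 2 / n + 16 / (n : ℝ) ^ 2)) := by
  have hM : (n.choose k : ℝ) ≤ n.choose (n / 2) := by exact_mod_cast choose_le_middle k n
  have hn' : (8 : ℝ) ≤ n := by exact_mod_cast hn
  have hk' : (2 : ℝ) ≤ k := by exact_mod_cast hk
  have hk1 : (1 : ℝ) / k ≤ 1 / 2 := one_div_le_one_div_of_le (by norm_num) hk'
  rcases le_or_gt n (2 * k + 2) with h | h
  · have h' : (n : ℝ) ≤ 2 * k + 2 := by exact_mod_cast h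
    have h1 : (1 : ℝ) / k ≤ 2 / (n - 2) := by
      rw [div_le_div_iff₀ (by linarith) (by linarith)]
      linarith
    have h2 : 1 ≤ (1 - 2 / ((n : ℝ) - 2)) * (1 + 2 / n + 16 / (n : ℝ) ^ 2) := by
      have : (n : ℝ) - 2 ≠ 0 := by linarith
      have e : (1 - 2 / ((n : ℝ) - 2)) * (1 + 2 / n + 16 / (n : ℝ) ^ 2) - 1 =
          8 * (n - 8) / ((n - 2) * n ^ 2) := by
        field_simp
        ring
      have : 0 ≤ 8 * ((n : ℝ) - 8) / ((n - 2) * n ^ 2) :=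
        div_nonneg (by linarith) (mul_nonneg (by linarith) (by positivity))
      linarith
    calc (n.choose k : ℝ) ≤ n.choose (n / 2) * 1 := by simpa using hM
      _ ≤ n.choose (n / 2) * ((1 - 1 / k) * (1 + 2 / n + 16 / (n : ℝ) ^ 2)) := by
        gcongr
        refine h2.trans ?_
        gcongr
      _ = _ := by ring
  · have h1 : (n.choose k : ℝ) * (n - k) ≤ n.choose (n / 2) * (k + 1) := by
      have h1 := choose_succ_right_eq n k
      have h2 := Nat.mul_le_mul_right (k + 1) (choose_le_middle (k + 1) n)
      rw [h1] at h2
      have : k ≤ n := by omega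
      exact_mod_cast h2
    have h3 : (k + 1 : ℝ) ≤ (1 - 1 / k) * (n - k) := by
      have e : (1 - 1 / k : ℝ) * (n - k) = (k - 1) * (n - k) / k := by
        field_simp
      rw [e, le_div_iff₀ (by linarith)]
      rcases hk.eq_or_lt with rfl | hk3
      · norm_num; linarith
      · have hk3' : (3 : ℝ) ≤ k := by exact_mod_cast hk3
        have h' : (2 * k + 3 : ℝ) ≤ n := by exact_mod_cast h
        nlinarith
    have hnk : (0 : ℝ) < n - k := by
      have : (2 * k + 3 : ℝ) ≤ n := by exact_mod_cast h
      linarith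
    have h4 : (n.choose k : ℝ) ≤ n.choose (n / 2) * (1 - 1 / k) := by
      refine le_of_mul_le_mul_right ?_ hnk
      calc _ ≤ _ := h1
        _ ≤ n.choose (n / 2) * ((1 - 1 / k) * (n - k)) := by gcongr
        _ = _ := by ring
    calc (n.choose k : ℝ) ≤ (1 - 1 / k) * (n.choose (n / 2) * 1) := by linarith
      _ ≤ _ := by
        gcongr
        · linarith
        · have : 0 ≤ 2 / (n : ℝ) + 16 / (n : ℝ) ^ 2 := by positivity
          linarith

open Numbering in
lemma factorial_le_card_prefixed_sdiff {n : ℕ} (hn : 8 ≤ n) {A B : Finset (Fin n)}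
    (hA : A.Nonempty) (hA' : A ≠ univ) (hB : B.Nonempty) (hB' : B ≠ univ) (hAB : A ≠ B) :
    (n ! : ℝ) ≤ #(prefixed A \ prefixed B) *
      (n.choose (n / 2) * (1 + 2 / n + 16 / (n : ℝ) ^ 2)) := by
  have ha : 0 < #A := hA.card_pos
  have han : #A < n := by simpa using (card_lt_iff_ne_univ A).2 hA'
  have hb : 0 < #B := hB.card_pos
  have hbn : #B < n := by simpa using (card_lt_iff_ne_univ B).2 hB'
  have hP : (#(prefixed A) : ℝ) * n.choose #A = n ! := by
    have h := choose_mul_factorial_mul_factorial han.le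
    have : #(prefixed A) * n.choose #A = n ! := by
      rw [card_prefixed, Fintype.card_fin, ← h]
      ring
    exact_mod_cast this
  -- it suffices that at most a `1 / k` proportion of the numberings with prefix `A` is lost
  have main : ∀ k, 2 ≤ k → n.choose k = n.choose #A →
      #(prefixed A ∩ prefixed B) * k ≤ #(prefixed A) → (n ! : ℝ) ≤ #(prefixed A \ prefixed B) *
        (n.choose (n / 2) * (1 + 2 / n + 16 / (n : ℝ) ^ 2)) := by
    intro k hk hC hI
    have hk0 : (0 : ℝ) < k := by positivity
    have hD : (#(prefixed A \ prefixed B) : ℝ) + #(prefixed A ∩ prefixed B) = #(prefixed A) := by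
      exact_mod_cast card_sdiff_add_card_inter _ _
    have hI' : (#(prefixed A ∩ prefixed B) : ℝ) ≤ #(prefixed A) * (1 / k) := by
      rw [mul_one_div, le_div_iff₀ hk0]
      exact_mod_cast hI
    have hmid := choose_le_middle_mul hn hk
    rw [hC] at hmid
    calc (n ! : ℝ) = #(prefixed A) * n.choose #A := hP.symm
      _ ≤ #(prefixed A) * ((1 - 1 / k) *
          (n.choose (n / 2) * (1 + 2 / n + 16 / (n : ℝ) ^ 2))) := by gcongr
      _ = (#(prefixed A) * (1 - 1 / k)) *
          (n.choose (n / 2) * (1 + 2 / n + 16 / (n : ℝ) ^ 2)) := by ring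
      _ ≤ _ := by
        gcongr
        linarith
  by_cases hsub : A ⊆ B
  · have hlt : #A < #B := card_lt_card (hsub.ssubset_of_ne hAB)
    refine main (n - #A) (by omega) (choose_symm han.le) ?_
    have h1 := card_prefixed_inter_prefixed_le hsub
    have h2 := le_choose_self (m := n - #A) (k := #B - #A) (by omega) (by omega)
    have h3 := choose_mul_factorial_mul_factorial (n := n - #A) (k := #B - #A) (by omega)
    rw [show n - #A - (#B - #A) = n - #B by omega] at h3
    simp only [Fintype.card_fin] at h1
    calc _ ≤ (#A)! * ((#B - #A)! * (n - #B)!) * (n - #A).choose (#B - #A) := Nat.mul_le_mul h1 h2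
      _ = (#A)! * ((n - #A).choose (#B - #A) * (#B - #A)! * (n - #B)!) := by ring
      _ = _ := by rw [h3, card_prefixed, Fintype.card_fin]
  by_cases hsub' : B ⊆ A
  · have hlt : #B < #A := card_lt_card (hsub'.ssubset_of_ne hAB.symm)
    refine main #A (by omega) rfl ?_
    have h1 := card_prefixed_inter_prefixed_le hsub'
    have h2 := le_choose_self (m := #A) (k := #B) (by omega) (by omega)
    have h3 := choose_mul_factorial_mul_factorial hlt.le
    simp only [Fintype.card_fin, inter_comm (prefixed B)] at h1
    calc _ ≤ (#B)! * ((#A - #B)! * (n - #A)!) * (#A).choose #B := Nat.mul_le_mul h1 h2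
      _ = ((#A).choose #B * (#B)! * (#A - #B)!) * (n - #A)! := by ring
      _ = _ := by rw [h3, card_prefixed, Fintype.card_fin]
  · rw [sdiff_eq_self_of_disjoint (disjoint_prefixed_prefixed hsub hsub'), ← hP]
    have h1 : (n.choose #A : ℝ) ≤ n.choose (n / 2) := by exact_mod_cast choose_le_middle _ n
    have h2 : 0 ≤ 2 / (n : ℝ) + 16 / (n : ℝ) ^ 2 := by positivity
    gcongr
    exact h1.trans (le_mul_of_one_le_right (by positivity) (by linarith))

/-- Griggs–Katona upper bound: there is a constant `c > 0` such
that every N-free family `F` in the `n`-dimensional Boolean lattice satisfies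
`|F| ≤ C(n,⌊n/2⌋) · (1 + 2/n + c/n²)`. -/
theorem stmt_12 :
    ∃ c : ℝ, 0 < c ∧ ∀ n : ℕ, 0 < n →
      ∀ F : Finset (Finset (Fin n)), IsNFree F →
        (F.card : ℝ) ≤ (n.choose (n / 2) : ℝ) * (1 + 2 / n + c / (n : ℝ) ^ 2) := by
  classical
  refine ⟨10000, by norm_num, fun n hn F hF => ?_⟩
  have hn0 : (0 : ℝ) < n := by exact_mod_cast hn
  rcases lt_or_ge n 8 with hn8 | hn8
  · have h1 : (F.card : ℝ) ≤ 128 := by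
      have h1 : #F ≤ 2 ^ n := by simpa using card_le_univ F
      have h2 : 2 ^ n ≤ 2 ^ 7 := Nat.pow_le_pow_right (by norm_num) (by omega)
      exact_mod_cast h1.trans h2
    have h2 : (1 : ℝ) ≤ n.choose (n / 2) := by
      exact_mod_cast Nat.choose_pos (Nat.div_le_self n 2)
    have h3 : (128 : ℝ) ≤ 10000 / (n : ℝ) ^ 2 := by
      rw [le_div_iff₀ (by positivity)]
      have : (n : ℝ) ≤ 7 := by exact_mod_cast (by omega : n ≤ 7)
      nlinarith
    have h4 : (128 : ℝ) ≤ 1 + 2 / n + 10000 / (n : ℝ) ^ 2 := by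
      have : 0 ≤ 2 / (n : ℝ) := by positivity
      linarith
    calc (F.card : ℝ) ≤ 1 * 128 := by linarith
      _ ≤ _ := by gcongr
  set K : ℝ := n.choose (n / 2) * (1 + 2 / n + 16 / (n : ℝ) ^ 2) with hK
  obtain ⟨p, hp, hpair⟩ := hF.exists_partner
  let G := (F.erase ∅).erase univ
  have hG : ∀ A ∈ G, A ∈ F ∧ A.Nonempty ∧ A ≠ univ := by
    intro A hA
    simp only [G, mem_erase] at hA
    exact ⟨hA.2.2, nonempty_iff_ne_empty.2 hA.2.1, hA.1⟩
  -- the complement stands in for a missing partner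
  let q : Finset (Fin n) → Finset (Fin n) := fun A =>
    if p A = none ∨ p A = some ∅ ∨ p A = some univ then Aᶜ else (p A).getD ∅
  have hq : ∀ A ∈ G, ∀ B ∈ G, p A = some B → q A = B := by
    intro A _ B hB h
    simp [q, h, (hG B hB).2.1.ne_empty, (hG B hB).2.2]
  have hq' : ∀ A ∈ G, (q A).Nonempty ∧ q A ≠ univ ∧ A ≠ q A := by
    intro A hA
    obtain ⟨-, hne, hnu⟩ := hG A hA
    by_cases h : p A = none ∨ p A = some ∅ ∨ p A = some univ
    · simp only [q, h, if_true]
      refine ⟨?_, ?_, ?_⟩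
      · rwa [nonempty_iff_ne_empty, Ne, compl_eq_empty_iff]
      · rw [Ne, compl_eq_univ_iff]
        exact hne.ne_empty
      · obtain ⟨x, hx⟩ := hne
        intro h'
        exact mem_compl.1 (h' ▸ hx) hx
    · obtain ⟨B, hB⟩ := Option.ne_none_iff_exists'.1 (not_or.1 h).1
      have hqA : q A = B := by
        simp only [q]
        rw [if_neg h, hB, Option.getD_some]
      rw [hB] at h
      simp only [Option.some.injEq, reduceCtorEq, false_or, not_or] at h
      rw [hqA]
      exact ⟨nonempty_iff_ne_empty.2 h.1, h.2, (hp A B hB).2⟩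
  let E : Finset (Fin n) → Finset (Numbering (Fin n)) := fun A =>
    Numbering.prefixed A \ Numbering.prefixed (q A)
  have hdisj : (G : Set (Finset (Fin n))).PairwiseDisjoint E := by
    have key : ∀ A ∈ G, ∀ B ∈ G, A ≠ B → ∀ f, f ∈ E A → f ∈ E B → #A ≤ #B → False := by
      intro A hA B hB hAB f hfA hfB hle
      simp only [E, mem_sdiff, Numbering.mem_prefixed] at hfA hfB
      have hsub := (hfA.1.subset_of_card_le_card hfB.1 hle).ssubset_of_ne hAB
      rcases hpair A (hG A hA).1 B (hG B hB).1 hsub with h | h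
      · exact hfA.2 (hq A hA B hB h ▸ hfB.1)
      · exact hfB.2 (hq B hB A hA h ▸ hfA.1)
    intro A hA B hB hAB
    refine disjoint_left.2 fun f hfA hfB => ?_
    rcases le_total #A #B with h | h
    · exact key A hA B hB hAB f hfA hfB h
    · exact key B hB A hA hAB.symm f hfB hfA h
  have hsum : ((∑ A ∈ G, #(E A) : ℕ) : ℝ) ≤ n ! := by
    rw [← card_biUnion hdisj]
    have := card_le_univ (G.biUnion E)
    simp only [Fintype.card_numbering, Fintype.card_fin] at this
    exact_mod_cast this
  have hK0 : 0 ≤ K := by positivity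
  have hGK : (#G : ℝ) ≤ K := by
    refine le_of_mul_le_mul_right ?_ (show 0 < (n ! : ℝ) by exact_mod_cast n.factorial_pos)
    calc (#G : ℝ) * n ! = ∑ A ∈ G, (n ! : ℝ) := by simp
      _ ≤ ∑ A ∈ G, #(E A) * K := sum_le_sum fun A hA =>
          factorial_le_card_prefixed_sdiff hn8 (hG A hA).2.1 (hG A hA).2.2 (hq' A hA).1
            (hq' A hA).2.1 (hq' A hA).2.2
      _ = ((∑ A ∈ G, #(E A) : ℕ) : ℝ) * K := by push_cast; rw [sum_mul]
      _ ≤ n ! * K := by gcongr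
      _ = K * n ! := mul_comm _ _
  have hFG : (#F : ℝ) ≤ #G + 2 := by
    have h1 := pred_card_le_card_erase (s := F) (a := ∅)
    have h2 := pred_card_le_card_erase (s := F.erase ∅) (a := univ)
    exact_mod_cast (show #F ≤ #G + 2 by simp only [G]; omega)
  have hM : (n : ℝ) ^ 2 ≤ 4 * n.choose (n / 2) := by
    have h1 : (n.choose 2 : ℝ) ≤ n.choose (n / 2) := by exact_mod_cast choose_le_middle 2 n
    rw [cast_choose_two] at h1
    have : (8 : ℝ) ≤ n := by exact_mod_cast hn8
    nlinarith
  have h2 : (2 : ℝ) ≤ n.choose (n / 2) * (8 / (n : ℝ) ^ 2) := by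
    rw [← mul_div_assoc, le_div_iff₀ (by positivity)]
    linarith
  calc (F.card : ℝ) ≤ K + n.choose (n / 2) * (8 / (n : ℝ) ^ 2) := by linarith
    _ = n.choose (n / 2) * (1 + 2 / n + 24 / (n : ℝ) ^ 2) := by rw [hK]; ring
    _ ≤ _ := by
      gcongr
      norm_num
end
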